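/- Let (U, τ) be a Curtis table for a based complex. For every i, the cardinality of the set U_i of untagged items equals the dimension of the homology H_i = ker d_i / im d_{i−1}. -/

import Mathlib

/-- The leading index (an element of `WithBot (Fin m)`, which is `⊥` exactly for the zero
vector) of a vector of the based `𝔽₂`-vector space `Fin m → ZMod 2`, whose ordered basis is
the standard one. -/
def lead {m : ℕ} (v : Fin m → ZMod 2) : WithBot (Fin m) :=
  (Finset.univ.filter fun j => v j ≠ 0).max

/-- `LTset S` is the set of leading indices of the nonzero elements of the subspace `S`. -/
def LTset {m : ℕ} (S : Submodule (ZMod 2) (Fin m → ZMod 2)) : Set (Fin m) :=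
  {j | ∃ v ∈ S, v ≠ 0 ∧ lead v = (j : WithBot (Fin m))}

/-- A based complex `X_0 → X_1 → ⋯ → X_N` of finite-dimensional `𝔽₂`-vector spaces with
ordered bases: `X_i` is modelled as `Fin (n i) → ZMod 2` via its ordered basis, and the
complex is extended by zero spaces in degrees `> N` (so `d_N = 0` holds automatically). -/
structure BasedComplex where
  N : ℕ
  n : ℕ → ℕ
  n_eq_zero : ∀ i, N < i → n i = 0
  d : ∀ i : ℕ, (Fin (n i) → ZMod 2) →ₗ[ZMod 2] (Fin (n (i + 1)) → ZMod 2)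
  d_comp : ∀ i, (d (i + 1)).comp (d i) = 0

namespace BasedComplex

/-- The cycles `ker d_i`. -/
def cyc (C : BasedComplex) (i : ℕ) : Submodule (ZMod 2) (Fin (C.n i) → ZMod 2) :=
  LinearMap.ker (C.d i)

/-- The boundaries `im d_{i-1}`, with the convention `d_{-1} = 0`. -/
def bdry (C : BasedComplex) : ∀ i : ℕ, Submodule (ZMod 2) (Fin (C.n i) → ZMod 2)
  | 0 => ⊥
  | (i + 1) => LinearMap.range (C.d i)

theorem bdry_zero (C : BasedComplex) : C.bdry 0 = ⊥ := rfl

theorem bdry_succ (C : BasedComplex) (i : ℕ) :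
    C.bdry (i + 1) = LinearMap.range (C.d i) := rfl

/-- The boundaries, viewed as a submodule of the cycles. -/
def bdryIn (C : BasedComplex) (i : ℕ) : Submodule (ZMod 2) (C.cyc i) :=
  (C.bdry i).comap (C.cyc i).subtype

/-- The homology `H_i = ker d_i / im d_{i-1}`. -/
abbrev homology (C : BasedComplex) (i : ℕ) :=
  C.cyc i ⧸ C.bdryIn i

end BasedComplex

/-- Given tag data `t`, where `t i k = some j` means that the basis index `k` of `X_i` is
tagged with target the basis index `j` of `X_{i+1}` (i.e. `τ_{i+1}(k) = j`),
`tagImage C t i` is the image of the partial function `τ_i` (which is empty for `i = 0`). -/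
def tagImage (C : BasedComplex) (t : ∀ i, Fin (C.n i) → Option (Fin (C.n (i + 1)))) :
    ∀ i : ℕ, Set (Fin (C.n i))
  | 0 => ∅
  | (i + 1) => {j | ∃ k, t i k = some j}

/-- A Curtis table for a based complex.  Here `t i` encodes the injective partial function
`τ_{i+1}` from the basis indices of `X_i` to the basis indices of `X_{i+1}`
(`t i k = some j` means `τ_{i+1}(k) = j`; the partial function `τ_0` is empty by
convention, and `τ_{N+1}` is automatically empty since `X_{N+1} = 0`). -/
structure CurtisTable (C : BasedComplex) where
  /-- the untagged items in each degree -/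
  U : ∀ i, Set (Fin (C.n i))
  /-- the tags -/
  t : ∀ i, Fin (C.n i) → Option (Fin (C.n (i + 1)))
  /-- the tags form an injective partial function -/
  t_inj : ∀ i k k' j, t i k = some j → t i k' = some j → k = k'
  /-- (i): `U_i` and the image of `τ_i` are disjoint … -/
  disj : ∀ i, Disjoint (U i) (tagImage C t i)
  /-- (i): … and their union is `LT(ker d_i)` -/
  union_eq : ∀ i, U i ∪ tagImage C t i = LTset (C.cyc i)
  /-- (ii): no index is both untagged and in the domain of `τ_{i+1}` -/
  mem_U_not_dom : ∀ i j, j ∈ U i → t i j = none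
  /-- (ii): no index is both in the image of `τ_i` and in the domain of `τ_{i+1}` -/
  mem_tagImage_not_dom : ∀ i j, j ∈ tagImage C t i → t i j = none
  /-- (ii): every basis index is untagged, or in the image of `τ_i`, or in the domain of
  `τ_{i+1}` -/
  cover : ∀ i j, j ∈ U i ∨ j ∈ tagImage C t i ∨ (t i j).isSome
  /-- (iii): if `τ_{i+1}(k) = j` then there is an `x` with leading index `k` such that
  `d_i x ≠ 0` and `d_i x` has leading index `j` -/
  tag_spec : ∀ i k j, t i k = some j →
    ∃ x : Fin (C.n i) → ZMod 2, lead x = (k : WithBot (Fin (C.n i))) ∧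
      C.d i x ≠ 0 ∧ lead (C.d i x) = (j : WithBot (Fin (C.n (i + 1))))

theorem lead_eq_coe_iff {m : ℕ} (v : Fin m → ZMod 2) (j : Fin m) :
    lead v = (j : WithBot (Fin m)) ↔ v j ≠ 0 ∧ ∀ k, j < k → v k = 0 := by
  constructor
  · intro h
    refine ⟨(Finset.mem_filter.mp (Finset.mem_of_max h)).2, fun k hk => ?_⟩
    by_contra hne
    exact absurd (Finset.le_max_of_eq (Finset.mem_filter.mpr ⟨Finset.mem_univ k, hne⟩) h)
      (not_le.mpr hk)
  · rintro ⟨hj, hk⟩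
    refine le_antisymm (Finset.max_le fun k hkm => ?_)
      (Finset.le_max (Finset.mem_filter.mpr ⟨Finset.mem_univ j, hj⟩))
    refine WithBot.coe_le_coe.mpr (not_lt.mp fun hlt => ?_)
    exact (Finset.mem_filter.mp hkm).2 (hk k hlt)

theorem exists_lead_eq_coe {m : ℕ} {v : Fin m → ZMod 2} (hv : v ≠ 0) :
    ∃ j : Fin m, lead v = (j : WithBot (Fin m)) := by
  obtain ⟨j, hj⟩ := Function.ne_iff.mp hv
  exact Finset.max_of_mem (Finset.mem_filter.mpr ⟨Finset.mem_univ j, hj⟩)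

/-- Vectors with pairwise distinct leading indices are linearly independent. -/
theorem linearIndependent_of_lead {m : ℕ} {s : Set (Fin m)} (v : s → Fin m → ZMod 2)
    (hv : ∀ j, lead (v j) = ((j : Fin m) : WithBot (Fin m))) :
    LinearIndependent (ZMod 2) v := by
  classical
  rw [Fintype.linearIndependent_iff]
  intro g hg j
  induction j using (wellFounded_gt (α := s)).induction with
  | _ j ih =>
    have hj := congrFun hg (j : Fin m)
    rw [Finset.sum_apply, Finset.sum_eq_single j] at hj
    · exact (mul_eq_zero.mp hj).resolve_right ((lead_eq_coe_iff _ _).mp (hv j)).1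
    · intro k _ hkj
      rcases lt_or_gt_of_ne hkj with hlt | hlt
      · simp [((lead_eq_coe_iff _ _).mp (hv k)).2 j hlt]
      · simp [ih k hlt]
    · simp

/-- The number of leading indices of a subspace is its dimension. -/
theorem ncard_LTset {m : ℕ} (S : Submodule (ZMod 2) (Fin m → ZMod 2)) :
    (LTset S).ncard = Module.finrank (ZMod 2) S := by
  classical
  rw [← Nat.card_coe_set_eq, Nat.card_eq_fintype_card]
  apply le_antisymm
  · choose v hvS _ hlead using fun j : LTset S => j.2
    have hli : LinearIndependent (ZMod 2) fun j : LTset S => (⟨v j, hvS j⟩ : S) :=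
      LinearIndependent.of_comp S.subtype (linearIndependent_of_lead v hlead)
    exact hli.fintype_card_le_finrank
  · let f : S →ₗ[ZMod 2] (LTset S → ZMod 2) :=
      (LinearMap.funLeft (ZMod 2) (ZMod 2) (Subtype.val : LTset S → Fin m)).comp S.subtype
    have hf : Function.Injective f := by
      rw [injective_iff_map_eq_zero]
      intro x hx
      by_contra hne
      have hx0 : (x : Fin m → ZMod 2) ≠ 0 := fun h => hne (Subtype.ext h)
      obtain ⟨j, hj⟩ := exists_lead_eq_coe hx0
      exact ((lead_eq_coe_iff _ _).mp hj).1 (congrFun hx ⟨j, x, x.2, hx0, hj⟩)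
    simpa using LinearMap.finrank_le_finrank_of_injective hf

theorem BasedComplex.bdry_le_cyc (C : BasedComplex) (i : ℕ) : C.bdry i ≤ C.cyc i := by
  cases i with
  | zero => exact bot_le
  | succ i => exact LinearMap.range_le_ker_iff.mpr (C.d_comp i)

theorem BasedComplex.finrank_homology_add (C : BasedComplex) (i : ℕ) :
    Module.finrank (ZMod 2) (C.homology i) + Module.finrank (ZMod 2) (C.bdry i) =
      Module.finrank (ZMod 2) (C.cyc i) := by
  rw [← (Submodule.comapSubtypeEquivOfLe (C.bdry_le_cyc i)).finrank_eq]
  exact Submodule.finrank_quotient_add_finrank (C.bdryIn i)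

namespace CurtisTable

variable {C : BasedComplex} (T : CurtisTable C)

/-- The tagged basis indices of `X_i` are those that are not leading indices of cycles. -/
theorem setOf_isSome_eq_compl (i : ℕ) : {k | (T.t i k).isSome} = (LTset (C.cyc i))ᶜ := by
  ext k
  rw [← T.union_eq i]
  have h₁ := T.mem_U_not_dom i k
  have h₂ := T.mem_tagImage_not_dom i k
  have h₃ := T.cover i k
  simp only [Set.mem_ofPred_eq, Set.mem_compl_iff, Set.mem_union]
  constructor
  · rintro h (hU | hI)
    · simp [h₁ hU] at h
    · simp [h₂ hI] at h
  · tauto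

/-- The tags restrict to a bijection from their domain to their image. -/
theorem ncard_tagImage_succ (i : ℕ) :
    (tagImage C T.t (i + 1)).ncard = {k | (T.t i k).isSome}.ncard := by
  symm
  refine Set.ncard_congr (fun k hk => (T.t i k).get hk) (fun k hk => ⟨k, by simp⟩) ?_ ?_
  · intro k k' hk hk' h
    exact T.t_inj i k k' _ (Option.some_get hk).symm (h ▸ (Option.some_get hk').symm)
  · rintro j ⟨k, hk⟩
    exact ⟨k, by simp [hk], by simp [hk]⟩

theorem ncard_tagImage (i : ℕ) :
    (tagImage C T.t i).ncard = Module.finrank (ZMod 2) (C.bdry i) := by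
  cases i with
  | zero =>
    rw [C.bdry_zero, finrank_bot]
    exact Set.ncard_empty _
  | succ i =>
    rw [T.ncard_tagImage_succ, T.setOf_isSome_eq_compl, C.bdry_succ]
    have h₁ := Set.ncard_add_ncard_compl (LTset (C.cyc i))
    have h₂ := (C.d i).finrank_range_add_finrank_ker
    rw [ncard_LTset, Nat.card_eq_fintype_card, Fintype.card_fin] at h₁
    rw [Module.finrank_fin_fun] at h₂
    change _ + Module.finrank (ZMod 2) (C.cyc i) = _ at h₂
    omega

end CurtisTable

/-- The number of untagged items in degree `i` equals the dimension of the homology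
`H_i = ker d_i / im d_{i-1}`. -/
theorem ncard_U_eq_finrank_homology (C : BasedComplex) (T : CurtisTable C) (i : ℕ) :
    (T.U i).ncard = Module.finrank (ZMod 2) (C.homology i) := by
  have h₁ := Set.ncard_union_eq (T.disj i)
  rw [T.union_eq i, ncard_LTset, T.ncard_tagImage i] at h₁
  have h₂ := C.finrank_homology_add i
  omega
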